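/- Let g = {g_1,…,g_t} be a complete intersection of homogeneous elements for a reduced graded complete intersection affine k-algebra Λ, let Γ = k[g_1,…,g_t], I = (g_1,…,g_t), and let h_1,…,h_k ∈ Λ be linearly independent over I (i.e. their classes in Λ/I are linearly independent over k). For μ ∈ Sp Γ set I_μ = (g_1−g_1(μ),…,g_t−g_t(μ)). Then: (1) there exists an open dense set U_1 ⊆ Sp Γ such that for every μ ∈ U_1 the elements h_1,…,h_k are linearly independent over I_μ; (2) there exists an open dense set U_2 ⊆ Sp Γ such that for every μ ∈ U_2 the restrictions of h_1,…,h_k to V(I_μ), as regular functions, are linearly independent over k. -/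

import Mathlib

open scoped TensorProduct

noncomputable section

universe u v w

/-- A sequence `g 0, …, g (t-1)` in a commutative ring is *regular* if for each `i`
the class of `g i` in the quotient by the ideal generated by the previous elements
is neither a zero divisor nor invertible. -/
def IsRegularSequence {Λ : Type u} [CommRing Λ] {t : ℕ} (g : Fin t → Λ) : Prop :=
  ∀ i : Fin t,
    ((∀ x : Λ, g i * x ∈ Ideal.span (g '' {j | j < i}) → x ∈ Ideal.span (g '' {j | j < i})) ∧
      Ideal.span (g '' {j | j ≤ i}) ≠ ⊤)

/-- The `i`-th differential of the Koszul complex of a sequence `g` of elements in a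
`k`-algebra `U`, where the `i`-th term of the complex is the free `U`-module on the
`i`-element subsets of `Fin t` (a model of `U ⊗ Λ^i k^t`), with
`d (u ⊗ e_{j₁} ∧ … ∧ e_{jᵢ}) = Σ (-1)^(m-1) (u * g jₘ) ⊗ e_{j₁} ∧ … ∧ ê_{jₘ} ∧ … ∧ e_{jᵢ}`. -/
noncomputable def koszulD (k : Type u) {U : Type v} [CommRing k] [Ring U] [Algebra k U]
    {t : ℕ} (g : Fin t → U) (i : ℕ) :
    ({s : Finset (Fin t) // s.card = i + 1} →₀ U) →ₗ[k] ({s : Finset (Fin t) // s.card = i} →₀ U) :=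
  Finsupp.lsum k fun s =>
    ∑ j ∈ s.1.attach,
      (Finsupp.lsingle (R := k)
          (⟨s.1.erase j.1, by simp [Finset.card_erase_of_mem j.2, s.2]⟩ :
            {s : Finset (Fin t) // s.card = i})).comp
        (LinearMap.mulRight k (((-1 : U) ^ (s.1.filter fun a => a < j.1).card) * g j.1))

/-- A sequence `g` of (mutually commuting) elements of a `k`-algebra `U` is a
*complete intersection for `U`* if the Koszul homology `H_i(g, U)` vanishes for `i ≠ 0`
and `H_0(g, U) = U/(U g 0 + … + U g (t-1)) ≠ 0`. -/
def IsCompleteIntersection (k : Type u) {U : Type v} [CommRing k] [Ring U] [Algebra k U]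
    {t : ℕ} (g : Fin t → U) : Prop :=
  (∀ i : ℕ, LinearMap.ker (koszulD k g i) = LinearMap.range (koszulD k g (i + 1))) ∧
    Submodule.span U (Set.range g) ≠ ⊤

/-- The Zariski topology on the "maximal spectrum" `Sp Λ` of an affine algebra over an
algebraically closed field, modelled by the set of `k`-characters of `Λ`: a basis of open
sets is given by the sets `{χ | χ f ≠ 0}`. -/
instance spTopology (k : Type u) (R : Type v) [CommSemiring k] [Semiring R] [Algebra k R] :
    TopologicalSpace (R →ₐ[k] k) :=
  TopologicalSpace.generateFrom {s | ∃ f : R, s = {χ : R →ₐ[k] k | χ f ≠ 0}}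

/-- The zero set `V(S) ⊆ Sp Λ` of a set of elements of `Λ`. -/
def spZeroLocus (k : Type u) {R : Type v} [CommSemiring k] [Semiring R] [Algebra k R]
    (S : Set R) : Set (R →ₐ[k] k) :=
  {χ | ∀ f ∈ S, χ f = 0}

/-- The dimension of a subset of a topological space. -/
noncomputable def setDim {X : Type u} [TopologicalSpace X] (S : Set X) : WithBot ℕ∞ :=
  topologicalKrullDim S

/-- A subset of a topological space is equidimensional of dimension `d` if it is nonempty
and all its irreducible components have dimension `d`. -/
def EquidimOfDim {X : Type u} [TopologicalSpace X] (S : Set X) (d : ℕ) : Prop :=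
  S.Nonempty ∧ ∀ C ∈ irreducibleComponents S, topologicalKrullDim C = (d : WithBot ℕ∞)

/-- The Cohen-Macaulay property as used in the paper: for every proper ideal `I`,
the depth of `I` (maximal length of a regular sequence contained in `I`) equals the
codimension of `I` (the minimal codimension in `Sp Λ` of an irreducible component of
`V(I)`, i.e. `dim Sp Λ - dim V(I)`). -/
def IsPaperCM (k : Type u) (Λ : Type v) [Field k] [CommRing Λ] [Algebra k Λ] : Prop :=
  ∀ I : Ideal Λ, I ≠ ⊤ → ∃ c : ℕ,
    (setDim (spZeroLocus k (I : Set Λ)) + (c : WithBot ℕ∞) =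
      topologicalKrullDim (Λ →ₐ[k] k)) ∧
    (∃ g : Fin c → Λ, (∀ i, g i ∈ I) ∧ IsRegularSequence g) ∧
    (∀ (m : ℕ) (g : Fin m → Λ), (∀ i, g i ∈ I) → IsRegularSequence g → m ≤ c)

/-- An affine `k`-algebra is a *reduced complete intersection* if it is isomorphic to a
quotient of a polynomial algebra by a radical ideal generated by a regular sequence. -/
def IsReducedCI (k : Type u) (B : Type v) [Field k] [CommRing B] [Algebra k B] : Prop :=
  ∃ (n t : ℕ) (f : Fin t → MvPolynomial (Fin n) k) (I : Ideal (MvPolynomial (Fin n) k)),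
    I = Ideal.span (Set.range f) ∧ IsRegularSequence f ∧ I.IsRadical ∧
      Nonempty ((MvPolynomial (Fin n) k ⧸ I) ≃ₐ[k] B)

section KoszulRegular

open MvPolynomial

variable {R : Type*} [CommRing R] {t : ℕ}

/-- Every relation `∑ aᵢ gᵢ = 0` is a combination of the trivial ones
`gⱼ eᵢ - gᵢ eⱼ`, i.e. the first Koszul homology of `g` vanishes. -/
def OnlyTrivialRelations (g : Fin t → R) : Prop :=
  ∀ a : Fin t → R, ∑ i, g i * a i = 0 →
    ∃ c : Fin t → Fin t → R, ∀ i, a i = ∑ j, (c i j - c j i) * g j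

theorem koszulD_single (k : Type*) [CommRing k] [Algebra k R] (g : Fin t → R) (i : ℕ)
    (s : {s : Finset (Fin t) // s.card = i + 1}) (u : R) :
    koszulD k g i (Finsupp.single s u) =
      ∑ j ∈ s.1.attach, Finsupp.single
        (⟨s.1.erase j.1, by simp [Finset.card_erase_of_mem j.2, s.2]⟩ :
          {s : Finset (Fin t) // s.card = i})
        (u * (((-1 : R) ^ (s.1.filter fun a => a < j.1).card) * g j.1)) := by
  simp [koszulD, -Finsupp.single_mul, mul_assoc]

theorem exists_koszulD_one_apply (k : Type*) [CommRing k] [Algebra k R] (g : Fin t → R)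
    (w : {s : Finset (Fin t) // s.card = 1 + 1} →₀ R) :
    ∃ c : Fin t → Fin t → R, ∀ i,
      koszulD k g 1 w ⟨{i}, by simp⟩ = ∑ j, (c i j - c j i) * g j := by
  classical
  induction w using Finsupp.induction_linear with
  | zero => exact ⟨0, by simp⟩
  | add w₁ w₂ h₁ h₂ =>
    obtain ⟨c₁, h₁⟩ := h₁
    obtain ⟨c₂, h₂⟩ := h₂
    refine ⟨c₁ + c₂, fun i => ?_⟩
    rw [map_add, Finsupp.add_apply, h₁, h₂, ← Finset.sum_add_distrib]
    refine Finset.sum_congr rfl fun j _ => ?_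
    simp only [Pi.add_apply]
    ring
  | single s u =>
    obtain ⟨s, hs⟩ := s
    obtain ⟨p, q, hpq, rfl⟩ : ∃ p q : Fin t, p < q ∧ s = {p, q} := by
      obtain ⟨x, y, hxy, rfl⟩ := Finset.card_eq_two.1 hs
      rcases lt_or_gt_of_ne hxy with h | h
      · exact ⟨x, y, h, rfl⟩
      · exact ⟨y, x, h, Finset.pair_comm _ _⟩
    refine ⟨fun i j => if i = q ∧ j = p then u else 0, fun i => ?_⟩
    have hp : (({p, q} : Finset (Fin t)).filter fun a => a < p) = ∅ := by
      ext a; simp; grind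
    have hq : (({p, q} : Finset (Fin t)).filter fun a => a < q) = {p} := by
      ext a; simp; grind
    have hep : ({p, q} : Finset (Fin t)).erase p = {q} := by
      ext a; simp; grind
    have heq : ({p, q} : Finset (Fin t)).erase q = {p} := by
      ext a; simp; grind
    rw [koszulD_single, Finsupp.finsetSum_apply]
    simp only [Finsupp.single_apply, Subtype.mk.injEq]
    rw [Finset.sum_attach ({p, q} : Finset (Fin t)) (fun j =>
      if ({p, q} : Finset (Fin t)).erase j = {i} then
        u * ((-1) ^ (({p, q} : Finset (Fin t)).filter fun a => a < j).card * g j) else 0),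
      Finset.sum_pair hpq.ne]
    simp only [hp, hq, hep, heq, sub_mul, Finset.sum_sub_distrib, Finset.singleton_inj]
    simp only [ite_mul, zero_mul, ite_and]
    by_cases h1 : i = q <;> by_cases h2 : i = p <;>
      simp [h1, h2, eq_comm, hpq.ne]; grind

theorem IsCompleteIntersection.onlyTrivialRelations {k : Type*} [CommRing k] [Algebra k R]
    {g : Fin t → R} (hg : IsCompleteIntersection k g) : OnlyTrivialRelations g := by
  classical
  intro a ha
  let w : {s : Finset (Fin t) // s.card = 0 + 1} →₀ R :=
    ∑ i, Finsupp.single ⟨{i}, by simp⟩ (a i)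
  have hw : w ∈ LinearMap.ker (koszulD k g 0) := by
    rw [LinearMap.mem_ker, map_sum]
    simp only [koszulD_single]
    have key : ∀ i : Fin t, ∑ j ∈ ({i} : Finset (Fin t)).attach, Finsupp.single
        (⟨({i} : Finset (Fin t)).erase j.1, by
          simp [Finset.card_erase_of_mem j.2]⟩ :
          {s : Finset (Fin t) // s.card = 0})
        (a i * (((-1 : R) ^ (({i} : Finset (Fin t)).filter fun b => b < j.1).card) * g j.1))
        = Finsupp.single ⟨∅, rfl⟩ (g i * a i) := by
      intro i
      rw [Finset.sum_eq_single ⟨i, Finset.mem_singleton_self i⟩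
        (fun b _ hb => absurd (Subtype.ext (Finset.mem_singleton.1 b.2)) hb)
        (fun h => absurd (Finset.mem_attach _ _) h)]
      congr 1
      · simp
      · simp [Finset.filter_singleton, mul_comm]
    refine (Finset.sum_congr rfl fun i _ => key i).trans ?_
    rw [← Finsupp.single_finsetSum, ha, Finsupp.single_zero]
  rw [hg.1 0] at hw
  obtain ⟨v, hv⟩ := hw
  obtain ⟨c, hc⟩ := exists_koszulD_one_apply k g v
  refine ⟨c, fun i => ?_⟩
  rw [← hc]
  change _ = (koszulD k g (0 + 1) v) _
  rw [hv]
  simp only [w, Finsupp.finsetSum_apply, Finsupp.single_apply, Subtype.mk.injEq,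
    Finset.singleton_inj]
  simp

theorem OnlyTrivialRelations.mvPolynomial {g : Fin t → R} (hg : OnlyTrivialRelations g)
    {σ : Type*} (a : Fin t → MvPolynomial σ R) (ha : ∑ i, C (g i) * a i = 0) :
    ∃ c : Fin t → Fin t → MvPolynomial σ R, ∀ i, a i = ∑ j, (c i j - c j i) * C (g j) := by
  classical
  have hd (d : σ →₀ ℕ) : ∑ i, g i * coeff d (a i) = 0 := by
    simpa [coeff_sum, coeff_C_mul] using congrArg (coeff d) ha
  choose c hc using fun d => hg _ (hd d)
  let D : Finset (σ →₀ ℕ) := Finset.univ.biUnion fun i => (a i).support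
  refine ⟨fun i j => ∑ d ∈ D, monomial d (c d i j), fun i => ?_⟩
  have h1 : a i = ∑ d ∈ D, monomial d (coeff d (a i)) := by
    conv_lhs => rw [(a i).as_sum]
    refine Finset.sum_subset (Finset.subset_biUnion_of_mem (fun i => (a i).support)
      (Finset.mem_univ i)) fun d _ hd => ?_
    rw [notMem_support_iff.1 hd, map_zero]
  rw [h1]
  simp_rw [← Finset.sum_sub_distrib, Finset.sum_mul]
  rw [Finset.sum_comm]
  refine Finset.sum_congr rfl fun d _ => ?_
  rw [hc d i, map_sum]
  refine Finset.sum_congr rfl fun j _ => ?_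
  rw [← map_sub, mul_comm _ (C _), C_mul_monomial, mul_comm]

theorem MvPolynomial.IsHomogeneous.exists_eq_sum_X_mul {σ : Type*} [Fintype σ] {n : ℕ}
    {F : MvPolynomial σ R} (hF : F.IsHomogeneous (n + 1)) :
    ∃ G : σ → MvPolynomial σ R, (∀ i, (G i).IsHomogeneous n) ∧ F = ∑ i, X i * G i := by
  classical
  have hmon : ∀ d ∈ F.support, ∃ G : σ → MvPolynomial σ R,
      (∀ i, (G i).IsHomogeneous n) ∧ monomial d (coeff d F) = ∑ i, X i * G i := by
    intro d hd
    have hdeg : d.degree = n + 1 := by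
      have := hF (mem_support_iff.1 hd)
      rw [Finsupp.degree_eq_weight_one]
      exact this
    obtain ⟨i, hi⟩ : ∃ i, d i ≠ 0 := by
      by_contra! h
      have : d = 0 := Finsupp.ext h
      simp [this] at hdeg
    have hle : Finsupp.single i 1 ≤ d := by
      simpa [Finsupp.single_le_iff, Nat.one_le_iff_ne_zero] using hi
    have hsub : d - Finsupp.single i 1 + Finsupp.single i 1 = d := tsub_add_cancel_of_le hle
    have hdeg' : (d - Finsupp.single i 1).degree = n := by
      have := congrArg Finsupp.degree hsub
      rw [map_add, Finsupp.degree_single, hdeg] at this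
      omega
    refine ⟨Pi.single i (monomial (d - Finsupp.single i 1) (coeff d F)), fun j => ?_, ?_⟩
    · by_cases h : j = i
      · subst h
        rw [Pi.single_eq_same]
        exact isHomogeneous_monomial _ hdeg'
      · rw [Pi.single_eq_of_ne h]
        exact isHomogeneous_zero _ _ _
    · rw [Finset.sum_eq_single i (fun j _ h => by rw [Pi.single_eq_of_ne h, mul_zero])
        (by simp), Pi.single_eq_same, X, monomial_mul, one_mul, add_comm, hsub]
  choose! G hG hGF using hmon
  refine ⟨fun i => ∑ d ∈ F.support, G d i, fun i => IsHomogeneous.sum _ _ _ fun d hd => hG d hd i,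
    ?_⟩
  conv_lhs => rw [F.as_sum]
  rw [Finset.sum_congr rfl hGF, Finset.sum_comm]
  simp_rw [Finset.mul_sum]

theorem sum_sum_mul_sub {ι A : Type*} [Fintype ι] [CommRing A] (c : ι → ι → A) (x y : ι → A) :
    ∑ i, ∑ j, c i j * (x i * y j - x j * y i) = ∑ j, y j * ∑ i, (c i j - c j i) * x i := by
  have h₁ : ∑ i, ∑ j, c i j * (x i * y j) = ∑ j, ∑ i, y j * (c i j * x i) := by
    rw [Finset.sum_comm]
    exact Finset.sum_congr rfl fun i _ => Finset.sum_congr rfl fun j _ => by ring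
  have h₂ : ∑ i, ∑ j, c i j * (x j * y i) = ∑ j, ∑ i, y j * (c j i * x i) :=
    Finset.sum_congr rfl fun i _ => Finset.sum_congr rfl fun j _ => by ring
  simp only [mul_sub, sub_mul, Finset.sum_sub_distrib, Finset.mul_sum, h₁, h₂]

/-- An ideal generated by a sequence with vanishing first Koszul homology is of linear type. -/
theorem OnlyTrivialRelations.exists_eq_sum {g : Fin t → R} (hg : OnlyTrivialRelations g) {n : ℕ}
    {F : MvPolynomial (Fin t) R} (hF : F.IsHomogeneous n) (h0 : eval g F = 0) :
    ∃ c : Fin t → Fin t → MvPolynomial (Fin t) R,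
      F = ∑ i, ∑ j, c i j * (X i * C (g j) - X j * C (g i)) := by
  induction n generalizing F with
  | zero =>
    refine ⟨0, ?_⟩
    have := (totalDegree_eq_zero_iff_eq_C (p := F)).1 (Nat.le_zero.1 hF.totalDegree_le)
    rw [this, eval_C] at h0
    rw [this, h0]
    simp
  | succ n ih =>
    obtain ⟨G, hG, rfl⟩ := hF.exists_eq_sum_X_mul
    have hhom : (∑ i, C (g i) * G i).IsHomogeneous n :=
      IsHomogeneous.sum _ _ _ fun i _ => (hG i).C_mul _
    obtain ⟨c, hc⟩ := ih hhom (by simpa using h0)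
    have hrel : ∑ j, C (g j) * (G j - ∑ i, (c i j - c j i) * X i) = 0 := by
      simp_rw [mul_sub (C _), Finset.sum_sub_distrib]
      rw [hc, sum_sum_mul_sub, sub_self]
    obtain ⟨s, hs⟩ := hg.mvPolynomial _ hrel
    refine ⟨s, ?_⟩
    have hsplit (j : Fin t) : X j * G j = X j * ∑ i, (c i j - c j i) * X i +
        X j * ∑ i, (s j i - s i j) * C (g i) := by
      rw [← mul_add, ← hs, add_sub_cancel]
    rw [Finset.sum_congr rfl fun j _ => hsplit j, Finset.sum_add_distrib,
      ← sum_sum_mul_sub c X X, ← sum_sum_mul_sub (fun i j => s j i) (fun i => C (g i)) X,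
      Finset.sum_comm (f := fun i j => s j i * _)]
    simp only [mul_comm (X _) (X _), sub_self, mul_zero, Finset.sum_const_zero, zero_add]
    exact Finset.sum_congr rfl fun i _ => Finset.sum_congr rfl fun j _ => by ring

/-- A sequence with vanishing first Koszul homology is quasi-regular. -/
theorem OnlyTrivialRelations.coeff_mem {g : Fin t → R} (hg : OnlyTrivialRelations g) {n : ℕ}
    {F : MvPolynomial (Fin t) R} (hF : F.IsHomogeneous n)
    (h : eval g F ∈ Ideal.span (Set.range g) ^ (n + 1)) (d : Fin t →₀ ℕ) :
    coeff d F ∈ Ideal.span (Set.range g) := by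
  have hmem (i : Fin t) :
      (C (g i) : MvPolynomial (Fin t) R) ∈ (Ideal.span (Set.range g)).map C :=
    Ideal.mem_map_of_mem _ (Ideal.subset_span (Set.mem_range_self i))
  obtain ⟨Q, hQ, hQF⟩ := (Ideal.mem_span_pow_iff_exists_isHomogeneous _ _).1 h
  obtain ⟨G, hG, rfl⟩ := hQ.exists_eq_sum_X_mul
  have hhom : (∑ i, C (g i) * G i).IsHomogeneous n :=
    IsHomogeneous.sum _ _ _ fun i _ => (hG i).C_mul _
  obtain ⟨c, hc⟩ := hg.exists_eq_sum (hF.sub hhom) (by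
    rw [map_sub, ← hQF, sub_eq_zero]; simp)
  have : F ∈ (Ideal.span (Set.range g)).map C := by
    rw [sub_eq_iff_eq_add.1 hc]
    refine add_mem (sum_mem fun i _ => sum_mem fun j _ => Ideal.mul_mem_left _ _ ?_)
      (sum_mem fun i _ => Ideal.mul_mem_right _ _ (hmem i))
    exact sub_mem (Ideal.mul_mem_left _ _ (hmem j)) (Ideal.mul_mem_left _ _ (hmem i))
  exact mem_map_C_iff.1 this d

theorem OnlyTrivialRelations.eq_zero_of_sum_aeval_mul_eq_zero {k : Type*} [Field k] [Algebra k R]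
    {g : Fin t → R} (hg : OnlyTrivialRelations g) {ι : Type*} [Fintype ι] {h : ι → R}
    (hh : LinearIndependent k fun j => Ideal.Quotient.mk (Ideal.span (Set.range g)) (h j))
    {p : ι → MvPolynomial (Fin t) k} (hp : ∑ j, aeval g (p j) * h j = 0) (j : ι) : p j = 0 := by
  have hcomp : ∀ n j, homogeneousComponent n (p j) = 0 := by
    intro n
    induction n using Nat.strong_induction_on with
    | _ n ih =>
      let q (j : ι) := homogeneousComponent n (p j)
      let F : MvPolynomial (Fin t) R := ∑ j, C (h j) * map (algebraMap k R) (q j)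
      have hF : F.IsHomogeneous n := IsHomogeneous.sum _ _ _ fun j _ =>
        ((homogeneousComponent_isHomogeneous n (p j)).map _).C_mul _
      have hpow {m : ℕ} {r : MvPolynomial (Fin t) k} (hr : r.IsHomogeneous m) :
          aeval g r ∈ Ideal.span (Set.range g) ^ m :=
        (Ideal.mem_span_pow_iff_exists_isHomogeneous _ _).2
          ⟨map (algebraMap k R) r, hr.map _, by rw [eval_map, aeval_def]⟩
      have hrest (j : ι) : aeval g (p j) - aeval g (q j) ∈ Ideal.span (Set.range g) ^ (n + 1) := by
        have hsum : p j = ∑ m ∈ Finset.range ((p j).totalDegree + 1 + n + 1),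
            homogeneousComponent m (p j) := by
          conv_lhs => rw [← sum_homogeneousComponent (p j)]
          refine Finset.sum_subset (Finset.range_subset_range.2 (by omega)) fun m _ hm => ?_
          exact homogeneousComponent_eq_zero _ _ (by simpa using hm)
        have hsplit : p j - q j = ∑ m ∈ (Finset.range ((p j).totalDegree + 1 + n + 1)).erase n,
            homogeneousComponent m (p j) := by
          rw [sub_eq_iff_eq_add, Finset.sum_erase_add _ _ (by simp)]
          exact hsum
        rw [← map_sub, hsplit, map_sum]
        refine sum_mem fun m hm => ?_
        rcases lt_or_gt_of_ne (Finset.ne_of_mem_erase hm) with hlt | hlt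
        · rw [ih m hlt, map_zero]
          exact zero_mem _
        · exact Ideal.pow_le_pow_right hlt (hpow (homogeneousComponent_isHomogeneous m (p j)))
      have hev : eval g F ∈ Ideal.span (Set.range g) ^ (n + 1) := by
        have : eval g F = -∑ j, (aeval g (p j) - aeval g (q j)) * h j := by
          simp_rw [sub_mul, Finset.sum_sub_distrib]
          rw [hp]
          simp only [F, map_sum, map_mul, eval_C, eval_map, zero_sub, neg_neg, aeval_def]
          exact Finset.sum_congr rfl fun j _ => mul_comm _ _
        rw [this]
        exact neg_mem (sum_mem fun j _ => Ideal.mul_mem_right _ _ (hrest j))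
      intro j
      ext d
      have hd := hg.coeff_mem hF hev d
      have hd' : ∑ j, coeff d (q j) • Ideal.Quotient.mk (Ideal.span (Set.range g)) (h j) = 0 := by
        rw [← Ideal.Quotient.eq_zero_iff_mem] at hd
        rw [← hd]
        simp only [F, coeff_sum, coeff_C_mul, coeff_map, map_sum, map_mul, Algebra.smul_def]
        exact Finset.sum_congr rfl fun j _ => mul_comm _ _
      simpa using Fintype.linearIndependent_iff.1 hh _ hd' j
  rw [← sum_homogeneousComponent (p j)]
  exact Finset.sum_eq_zero fun n _ => hcomp n j

end KoszulRegular

section GenericPoints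

open scoped nonZeroDivisors

variable {R : Type*} [CommRing R] [IsDomain R]

theorem exists_ringHom_extension_of_injective {A B k : Type*} [CommRing A] [CommRing B]
    [IsDomain B] [Algebra A B] [Algebra.IsIntegral A B] [FaithfulSMul A B] [Field k]
    [IsAlgClosed k] (μ : A →+* k) (hμ : Function.Injective μ) :
    ∃ ψ : B →+* k, ψ.comp (algebraMap A B) = μ := by
  have : IsDomain A := (FaithfulSMul.algebraMap_injective A B).isDomain
  let _ : Algebra A k := μ.toAlgebra
  have : FaithfulSMul A k := (faithfulSMul_iff_algebraMap_injective A k).2 hμ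
  have : Algebra.IsAlgebraic A B := inferInstance
  let φ : B →ₐ[A] k := IsAlgClosed.lift
  exact ⟨φ.toRingHom, φ.comp_algebraMap⟩

/-- A ring homomorphism to an algebraically closed field extends along an integral extension. -/
theorem exists_ringHom_extension_of_isIntegral {A B k : Type*} [CommRing A] [CommRing B]
    [Algebra A B] [Algebra.IsIntegral A B] [FaithfulSMul A B] [Field k] [IsAlgClosed k]
    (μ : A →+* k) : ∃ ψ : B →+* k, ψ.comp (algebraMap A B) = μ := by
  have hp : (RingHom.ker μ).IsPrime := RingHom.ker_isPrime μ
  obtain ⟨Q, -, hQ, hQμ⟩ := Ideal.exists_ideal_over_prime_of_isIntegral (RingHom.ker μ)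
    (⊥ : Ideal B) (by
      rw [← RingHom.ker_eq_comap_bot,
        (RingHom.injective_iff_ker_eq_bot _).1 (FaithfulSMul.algebraMap_injective A B)]
      exact bot_le)
  have hle : ∀ a ∈ Q.comap (algebraMap A B), μ a = 0 := fun a ha => by
    rwa [hQμ, RingHom.mem_ker] at ha
  have : FaithfulSMul (A ⧸ Q.comap (algebraMap A B)) (B ⧸ Q) :=
    (faithfulSMul_iff_algebraMap_injective _ _).2 Ideal.algebraMap_quotient_injective
  obtain ⟨ψ, hψ⟩ := exists_ringHom_extension_of_injective (B := B ⧸ Q)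
    (Ideal.Quotient.lift (Q.comap (algebraMap A B)) μ hle)
    ((Ideal.injective_lift_iff hle).2 hQμ.symm)
  refine ⟨ψ.comp (Ideal.Quotient.mk Q), ?_⟩
  ext r
  exact congrArg (fun f => f (Ideal.Quotient.mk _ r)) hψ

/-- Given finitely many elements of an algebraic extension `Ω` of the domain `R`, a general
homomorphism from `R` to an algebraically closed field extends to a subalgebra of `Ω`
containing these elements. -/
theorem exists_ne_zero_forall_exists_extension {Ω : Type*} [Field Ω] [Algebra R Ω]
    [FaithfulSMul R Ω] [Algebra.IsAlgebraic R Ω] (S : Finset Ω) :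
    ∃ f : R, f ≠ 0 ∧ ∀ (k : Type*) [Field k] [IsAlgClosed k] (μ : R →+* k), μ f ≠ 0 →
      ∃ (C : Subalgebra R Ω) (ψ : C →+* k), (S : Set Ω) ⊆ C ∧ ψ.comp (algebraMap R C) = μ := by
  classical
  have hint (s : Ω) : ∃ r : R, r ≠ 0 ∧ IsIntegral R (r • s) := by
    obtain ⟨r, hr, h⟩ := (Algebra.IsAlgebraic.isAlgebraic (R := R) s).exists_integral_multiple
    exact ⟨r, hr, h⟩
  choose r hr0 hr using hint
  let f := ∏ s ∈ S, r s
  have hf : ∀ s ∈ S, IsIntegral R (f • s) := by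
    intro s hs
    have : f • s = algebraMap R Ω (∏ x ∈ S.erase s, r x) * (r s • s) := by
      rw [← Algebra.smul_def, smul_smul, Finset.prod_erase_mul _ _ hs]
    rw [this]
    exact isIntegral_algebraMap.mul (hr s)
  refine ⟨f, Finset.prod_ne_zero_iff.2 fun s _ => hr0 s, fun k _ _ μ hμ => ?_⟩
  have hf0 : algebraMap R Ω f ≠ 0 := by
    rw [Ne, FaithfulSMul.algebraMap_eq_zero_iff]
    exact Finset.prod_ne_zero_iff.2 fun s _ => hr0 s
  let B := integralClosure R Ω
  have : FaithfulSMul R B := by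
    rw [faithfulSMul_iff_algebraMap_injective]
    refine Function.Injective.of_comp (f := algebraMap B Ω) ?_
    rw [← RingHom.coe_comp, ← IsScalarTower.algebraMap_eq]
    exact FaithfulSMul.algebraMap_injective R Ω
  obtain ⟨ψ₀, hψ₀⟩ := exists_ringHom_extension_of_isIntegral (B := B) μ
  let b : B := algebraMap R B f
  have hbu : IsUnit (ψ₀ b) := by
    have : ψ₀ b = μ f := by rw [← hψ₀]; rfl
    rw [this]
    exact hμ.isUnit
  let ψ₁ : Localization.Away b →+* k := IsLocalization.Away.lift b hbu
  have hbΩ : algebraMap B Ω b ≠ 0 := by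
    rwa [← IsScalarTower.algebraMap_apply R B Ω]
  let ι : Localization.Away b →ₐ[B] Ω :=
    IsLocalization.liftAlgHom (M := Submonoid.powers b) (f := Algebra.ofId B Ω) (by
      intro y
      obtain ⟨n, hn⟩ := y.2
      rw [← hn]
      exact ((IsUnit.mk0 _ hbΩ).pow n).map (RingHom.id Ω))
  have hι : Function.Injective ι := by
    rw [injective_iff_map_eq_zero]
    intro x hx
    obtain ⟨y, s, rfl⟩ := IsLocalization.exists_mk'_eq (Submonoid.powers b) x
    have h1 : ι (algebraMap B _ y) = 0 := by
      rw [← IsLocalization.mk'_spec (Localization.Away b) y s, map_mul, hx, zero_mul]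
    rw [AlgHom.commutes] at h1
    rw [IsLocalization.mk'_eq_zero_iff]
    exact ⟨1, by simpa using (FaithfulSMul.algebraMap_eq_zero_iff B Ω).1 h1⟩
  let e := AlgEquiv.ofInjective (ι.restrictScalars R) hι
  refine ⟨(ι.restrictScalars R).range, ψ₁.comp e.symm.toAlgHom.toRingHom, ?_, ?_⟩
  · intro s hs
    let y : B := ⟨f • s, hf s hs⟩
    let x : Localization.Away b :=
      IsLocalization.mk' _ y (⟨b, Submonoid.mem_powers b⟩ : Submonoid.powers b)
    refine ⟨x, mul_right_cancel₀ hbΩ ?_⟩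
    have hx : x * algebraMap B _ b = algebraMap B _ y :=
      IsLocalization.mk'_spec (Localization.Away b) y ⟨b, Submonoid.mem_powers b⟩
    have hιx : ι x * algebraMap B Ω b = algebraMap B Ω y := by
      rw [← ι.commutes b, ← map_mul, hx, ι.commutes]
    refine hιx.trans ?_
    rw [mul_comm]
    exact Algebra.smul_def f s
  · ext x
    have : e.symm (algebraMap R _ x) = algebraMap B _ (algebraMap R B x) := by
      rw [AlgEquiv.commutes, ← IsScalarTower.algebraMap_apply]
    change ψ₁ (e.symm (algebraMap R _ x)) = μ x
    rw [this, IsLocalization.Away.lift_eq, ← hψ₀]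
    rfl

theorem nonempty_algHom_of_finiteType (K A Ω : Type*) [Field K] [CommRing A] [Nontrivial A]
    [Algebra K A] [Algebra.FiniteType K A] [Field Ω] [IsAlgClosed Ω] [Algebra K Ω] :
    Nonempty (A →ₐ[K] Ω) := by
  obtain ⟨m, hm⟩ := Ideal.exists_maximal A
  let _ : Field (A ⧸ m) := Ideal.Quotient.field m
  have : Module.Finite K (A ⧸ m) := finite_of_finite_type_of_isJacobsonRing _ _
  have : Module.IsTorsionFree K (A ⧸ m) :=
    Module.isTorsionFree_iff_algebraMap_injective.2 (algebraMap K (A ⧸ m)).injective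
  let φ : (A ⧸ m) →ₐ[K] Ω := IsAlgClosed.lift
  exact ⟨φ.comp (Ideal.Quotient.mkₐ K m)⟩

/-- A Nullstellensatz over a domain: an element vanishing at all points with values in the
algebraic closure of the fraction field is nilpotent up to torsion. -/
theorem exists_smul_eq_zero_of_forall_algHom_eq_zero {Λ Ω : Type*} [CommRing Λ] [IsReduced Λ]
    [Algebra R Λ] [Algebra.FiniteType R Λ] [Field Ω] [IsAlgClosed Ω] [Algebra R Ω]
    [FaithfulSMul R Ω] (a : Λ) (ha : ∀ χ : Λ →ₐ[R] Ω, χ a = 0) : ∃ s : R, s ≠ 0 ∧ s • a = 0 := by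
  let K := FractionRing R
  let _ : Algebra K Ω := FractionRing.liftAlgebra R Ω
  have : IsScalarTower R K Ω := inferInstance
  let A := TensorProduct R K Λ
  let a' : A := 1 ⊗ₜ a
  have hnil : IsNilpotent a' := by
    by_contra hnil
    have hnt : Nontrivial (Localization.Away a') := by
      rw [← not_subsingleton_iff_nontrivial, IsLocalization.subsingleton_iff
        (M := Submonoid.powers a')]
      rintro ⟨n, hn⟩
      exact hnil ⟨n, hn⟩
    have hft : Algebra.FiniteType K (Localization.Away a') :=
      .trans (S := A) inferInstance (IsLocalization.finiteType_of_monoid_fg (Submonoid.powers a') _)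
    obtain ⟨φ⟩ := nonempty_algHom_of_finiteType K (Localization.Away a') Ω
    let θ : A →ₐ[K] Ω :=
      φ.comp (IsScalarTower.toAlgHom K A (Localization.Away a'))
    have hθ : θ a' ≠ 0 :=
      ((IsLocalization.Away.algebraMap_isUnit (S := Localization.Away a') a').map φ).ne_zero
    exact hθ (ha ((θ.restrictScalars R).comp Algebra.TensorProduct.includeRight))
  obtain ⟨n, hn⟩ := hnil
  have hn' : TensorProduct.mk R K Λ 1 (a ^ n) = 0 := by
    exact (map_pow (Algebra.TensorProduct.includeRight : Λ →ₐ[R] TensorProduct R K Λ) a n).trans hn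
  obtain ⟨s, hs⟩ := (IsLocalizedModule.eq_zero_iff R⁰ (TensorProduct.mk R K Λ 1)).1 hn'
  refine ⟨s, nonZeroDivisors.ne_zero s.2, ?_⟩
  refine (isReduced_iff Λ).1 inferInstance _ ⟨n + 1, ?_⟩
  have hs' : (s : R) • a ^ n = 0 := hs
  calc ((s : R) • a) ^ (n + 1) = ((s : R) ^ n • (s : R) • a ^ n) * a := by
        rw [smul_smul, ← pow_succ, smul_mul_assoc, ← pow_succ, smul_pow]
    _ = 0 := by rw [hs', smul_zero, zero_mul]

/-- If the component functions of `F` satisfy no linear relation, then the coordinate vectors are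
linear combinations of values of `F`. -/
theorem exists_finsupp_sum_eq_single {Ω X ι : Type*} [Field Ω] [Fintype ι] [DecidableEq ι]
    {F : X → ι → Ω} (hF : ∀ c : ι → Ω, (∀ x, ∑ j, c j * F x j = 0) → c = 0) (j : ι) :
    ∃ a : X →₀ Ω, ∀ l, (a.sum fun x b => b * F x l) = Pi.single (M := fun _ => Ω) j 1 l := by
  have htop : Submodule.span Ω (Set.range F) = ⊤ := by
    by_contra h
    obtain ⟨φ, hφ, hle⟩ := Submodule.exists_le_ker_of_lt_top _ (lt_top_iff_ne_top.2 h)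
    have hsum (v : ι → Ω) : φ v = ∑ j, φ (Pi.single j 1) * v j := by
      conv_lhs => rw [pi_eq_sum_univ' v]
      simp [mul_comm]
    have := hF (fun j => φ (Pi.single j 1)) fun x => by
      rw [← hsum]
      exact hle (Submodule.subset_span (Set.mem_range_self x))
    refine hφ (LinearMap.ext fun v => ?_)
    rw [hsum]
    simp [funext_iff] at this
    simp [this]
  have : (Pi.single j 1 : ι → Ω) ∈ Submodule.span Ω (Set.range F) := htop ▸ Submodule.mem_top
  obtain ⟨a, ha⟩ := Finsupp.mem_span_range_iff_exists_finsupp.1 this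
  refine ⟨a, fun l => ?_⟩
  rw [← ha]
  simp [Finsupp.sum, Finset.sum_apply]

/-- For a reduced algebra over a domain of characteristic zero, elements which are linearly
independent over the domain satisfy no linear relation as functions on the points with values in
the algebraic closure of the fraction field. -/
theorem eq_zero_of_forall_algHom_sum_eq_zero (K : Type*) {Ω Λ ι : Type*} [Field K] [Algebra R K]
    [IsFractionRing R K] [Field Ω] [Algebra K Ω] [IsAlgClosure K Ω] [Algebra R Ω]
    [IsScalarTower R K Ω] [CharZero R] [CommRing Λ] [IsReduced Λ]
    [Algebra R Λ] [Algebra.FiniteType R Λ] [Fintype ι] {h : ι → Λ} (hh : LinearIndependent R h)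
    (c : ι → Ω) (hc : ∀ χ : Λ →ₐ[R] Ω, ∑ j, c j * χ (h j) = 0) : c = 0 := by
  have : IsAlgClosed Ω := IsAlgClosure.isAlgClosed K
  have : Algebra.IsAlgebraic K Ω := IsAlgClosure.isAlgebraic
  have : CharZero K := charZero_of_injective_algebraMap (IsFractionRing.injective R K)
  have : FaithfulSMul R Ω := by
    rw [faithfulSMul_iff_algebraMap_injective, IsScalarTower.algebraMap_eq R K Ω]
    exact (algebraMap K Ω).injective.comp (IsFractionRing.injective R K)
  let L := IntermediateField.adjoin K (Set.range c)
  have hfin : FiniteDimensional K L :=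
    IntermediateField.finiteDimensional_adjoin fun x _ => Algebra.IsIntegral.isIntegral x
  let c' (j : ι) : L := ⟨c j, IntermediateField.subset_adjoin _ _ (Set.mem_range_self j)⟩
  have hσ (σ : L →ₐ[K] Ω) (χ : Λ →ₐ[R] Ω) : ∑ j, σ (c' j) * χ (h j) = 0 := by
    obtain ⟨τ, hτ⟩ := IsAlgClosed.surjective_domRestrict_of_isAlgebraic (E := Ω) σ
    let e : Ω ≃ₐ[K] Ω := AlgEquiv.ofBijective τ (Algebra.IsAlgebraic.algHom_bijective τ)
    have := congrArg e (hc (((e.symm : Ω →ₐ[K] Ω).restrictScalars R).comp χ))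
    rw [map_zero, map_sum] at this
    rw [← this]
    refine Finset.sum_congr rfl fun j _ => ?_
    rw [map_mul, ← hτ]
    congr 1
    exact (e.apply_symm_apply _).symm
  have htr (b : L) (χ : Λ →ₐ[R] Ω) :
      ∑ j, algebraMap K Ω (Algebra.trace K L (b * c' j)) * χ (h j) = 0 := by
    simp_rw [trace_eq_sum_embeddings Ω, map_mul, Finset.sum_mul]
    rw [Finset.sum_comm]
    refine Finset.sum_eq_zero fun σ _ => ?_
    simp_rw [mul_assoc, ← Finset.mul_sum, hσ, mul_zero]
  have hzero (b : L) (j : ι) : Algebra.trace K L (b * c' j) = 0 := by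
    obtain ⟨d, hd⟩ := IsLocalization.exist_integer_multiples_of_finite R⁰
      fun j => Algebra.trace K L (b * c' j)
    choose r hr using hd
    obtain ⟨s, hs, hsa⟩ := exists_smul_eq_zero_of_forall_algHom_eq_zero (Ω := Ω)
      (∑ j, r j • h j) fun χ => by
        have := congrArg (algebraMap R Ω d * ·) (htr b χ)
        simp only [mul_zero, Finset.mul_sum] at this
        rw [← this, map_sum]
        refine Finset.sum_congr rfl fun j _ => ?_
        rw [map_smul, Algebra.smul_def, IsScalarTower.algebraMap_apply R K Ω, hr j,
          Algebra.smul_def, map_mul, ← mul_assoc, ← IsScalarTower.algebraMap_apply]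
    simp_rw [Finset.smul_sum, smul_smul] at hsa
    have hrj : r j = 0 :=
      (mul_eq_zero.1 (Fintype.linearIndependent_iff.1 hh _ hsa j)).resolve_left hs
    have := hr j
    rw [hrj, map_zero, eq_comm, Algebra.smul_def, mul_eq_zero] at this
    exact this.resolve_left fun h0 => nonZeroDivisors.ne_zero d.2
      ((FaithfulSMul.algebraMap_eq_zero_iff R K).1 h0)
  funext j
  by_contra hj
  have hj' : c' j ≠ 0 := fun h0 => hj (congrArg Subtype.val h0)
  have := hzero (c' j)⁻¹ j
  rw [inv_mul_cancel₀ hj', ← map_one (algebraMap K L), Algebra.trace_algebraMap] at this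
  simp [Module.finrank_pos.ne'] at this

/-- For a reduced algebra of finite type over a domain of characteristic zero, elements which are
linearly independent over the domain are linearly independent as functions on a general fibre. -/
theorem exists_ne_zero_forall_fiber_independent {Λ ι : Type*} [CharZero R] [CommRing Λ]
    [IsReduced Λ] [Algebra R Λ] [Algebra.FiniteType R Λ] [Fintype ι] {h : ι → Λ}
    (hh : LinearIndependent R h) :
    ∃ f : R, f ≠ 0 ∧ ∀ (k : Type*) [Field k] [IsAlgClosed k] (μ : R →+* k), μ f ≠ 0 →
      ∀ c : ι → k, (∀ χ : Λ →+* k, χ.comp (algebraMap R Λ) = μ → ∑ j, c j * χ (h j) = 0) →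
        c = 0 := by
  classical
  let K := FractionRing R
  let Ω := AlgebraicClosure K
  have : FaithfulSMul R Ω := by
    rw [faithfulSMul_iff_algebraMap_injective, IsScalarTower.algebraMap_eq R K Ω]
    exact (algebraMap K Ω).injective.comp (IsFractionRing.injective R K)
  have : Algebra.IsAlgebraic R Ω :=
    (IsFractionRing.comap_isAlgebraic_iff (A := R) (K := K) (C := Ω)).2 inferInstance
  choose a ha using exists_finsupp_sum_eq_single
    (F := fun (χ : Λ →ₐ[R] Ω) j => χ (h j)) (eq_zero_of_forall_algHom_sum_eq_zero K hh)
  obtain ⟨G, hG⟩ := (Algebra.FiniteType.out : (⊤ : Subalgebra R Λ).FG)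
  let X : Finset (Λ →ₐ[R] Ω) := Finset.univ.biUnion fun j => (a j).support
  let S : Finset Ω := (Finset.univ.biUnion fun j => (a j).support.image (a j)) ∪
    X.biUnion fun χ => G.image χ
  obtain ⟨f, hf, H⟩ := exists_ne_zero_forall_exists_extension (R := R) S
  refine ⟨f, hf, fun k _ _ μ hμ c hc => ?_⟩
  obtain ⟨C, ψ, hSC, hψ⟩ := H k μ hμ
  have hχ (χ) (hχX : χ ∈ X) (x : Λ) : χ x ∈ C := by
    have hle : (⊤ : Subalgebra R Λ) ≤ C.comap χ := by
      rw [← hG, Algebra.adjoin_le_iff]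
      intro y hy
      refine hSC (Finset.mem_union_right _ (Finset.mem_biUnion.2 ⟨χ, hχX, ?_⟩))
      exact Finset.mem_image_of_mem _ hy
    exact hle Algebra.mem_top
  have haC (j) (χ) : a j χ ∈ C := by
    by_cases h0 : a j χ = 0
    · rw [h0]
      exact zero_mem C
    · refine hSC (Finset.mem_union_left _ (Finset.mem_biUnion.2 ⟨j, Finset.mem_univ j, ?_⟩))
      exact Finset.mem_image_of_mem _ (Finsupp.mem_support_iff.2 h0)
  have hpt (χ) (hχX : χ ∈ X) : ∑ l, c l * ψ ⟨χ (h l), hχ χ hχX (h l)⟩ = 0 := by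
    refine hc (ψ.comp (χ.codRestrict C (hχ χ hχX)).toRingHom) ?_
    rw [← hψ]
    ext r
    simp
  funext j
  have hsum (l : ι) : ∑ χ ∈ (a j).support.attach, ψ ⟨a j χ, haC j χ⟩ *
      ψ ⟨χ.1 (h l), hχ χ.1 (Finset.mem_biUnion.2 ⟨j, Finset.mem_univ j, χ.2⟩) (h l)⟩ =
        Pi.single (M := fun _ => k) j 1 l := by
    simp_rw [← map_mul, ← map_sum]
    have : (∑ χ ∈ (a j).support.attach, (⟨a j χ, haC j χ⟩ : C) *
      ⟨χ.1 (h l), hχ χ.1 (Finset.mem_biUnion.2 ⟨j, Finset.mem_univ j, χ.2⟩) (h l)⟩) =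
        Pi.single (M := fun _ => C) j 1 l := by
      refine Subtype.ext ?_
      have := ha j l
      rw [Finsupp.sum, ← Finset.sum_attach] at this
      rw [AddSubmonoidClass.coe_finsetSum]
      refine this.trans ?_
      by_cases hl : l = j
      · subst hl; simp
      · simp [hl]
    rw [this]
    by_cases hl : l = j
    · subst hl; simp
    · simp [hl]
  have : c j = ∑ l, c l * Pi.single (M := fun _ => k) j 1 l := by
    simp [Pi.single_apply]
  rw [this]
  simp_rw [← hsum, Finset.mul_sum]
  rw [Finset.sum_comm]
  refine Finset.sum_eq_zero fun χ _ => ?_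
  rw [Finset.sum_congr rfl fun l _ => mul_left_comm (c l) _ _, ← Finset.mul_sum,
    hpt _ (Finset.mem_biUnion.2 ⟨j, Finset.mem_univ j, χ.2⟩), mul_zero]

end GenericPoints

section AdjoinRelations

open MvPolynomial

variable {k Λ : Type*} [Field k] [CommRing Λ] [Algebra k Λ] {t : ℕ} {g : Fin t → Λ}

theorem OnlyTrivialRelations.algebraicIndependent (hg : OnlyTrivialRelations g)
    (hI : Ideal.span (Set.range g) ≠ ⊤) : AlgebraicIndependent k g := by
  have := Ideal.Quotient.nontrivial_iff.2 hI
  rw [algebraicIndependent_iff]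
  intro p hp
  refine hg.eq_zero_of_sum_aeval_mul_eq_zero (ι := Unit) (h := fun _ => 1) (p := fun _ => p)
    ?_ (by simpa using hp) ()
  rw [linearIndependent_unique_iff]
  simp

theorem OnlyTrivialRelations.linearIndependent_adjoin (hg : OnlyTrivialRelations g) {ι : Type*}
    [Fintype ι] {h : ι → Λ}
    (hh : LinearIndependent k fun j => Ideal.Quotient.mk (Ideal.span (Set.range g)) (h j)) :
    LinearIndependent (Algebra.adjoin k (Set.range g)) h := by
  rw [Fintype.linearIndependent_iff]
  intro γ hγ
  have hp (j : ι) : ∃ p : MvPolynomial (Fin t) k, aeval g p = (γ j : Λ) :=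
    (Algebra.adjoin_range_eq_range_aeval k g).le (γ j).2
  choose p hp using hp
  intro j
  refine Subtype.ext ?_
  rw [← hp j, hg.eq_zero_of_sum_aeval_mul_eq_zero hh (p := p) ?_ j, map_zero]
  · rfl
  · simpa [hp, Algebra.smul_def] using hγ

end AdjoinRelations

section Spectrum

theorem isOpen_setOf_algHom_ne_zero {k R : Type*} [CommSemiring k] [Semiring R] [Algebra k R]
    (f : R) : IsOpen {χ : R →ₐ[k] k | χ f ≠ 0} :=
  TopologicalSpace.isOpen_generateFrom_of_mem ⟨f, rfl⟩

theorem isTopologicalBasis_setOf_algHom_ne_zero {k R : Type*} [Field k] [Semiring R]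
    [Algebra k R] : TopologicalSpace.IsTopologicalBasis
      {s | ∃ f : R, s = {χ : R →ₐ[k] k | χ f ≠ 0}} where
  exists_subset_inter := by
    rintro _ ⟨f, rfl⟩ _ ⟨f', rfl⟩ χ ⟨hχ, hχ'⟩
    refine ⟨_, ⟨f * f', rfl⟩, ?_, fun ψ hψ => ?_⟩
    · simpa using ⟨hχ, hχ'⟩
    · simpa using hψ
  sUnion_eq := Set.eq_univ_of_forall fun χ => ⟨_, ⟨1, rfl⟩, by simp⟩
  eq_generateFrom := rfl

theorem dense_setOf_algHom_ne_zero {k R : Type*} [Field k] [IsAlgClosed k] [CommRing R]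
    [IsDomain R] [Algebra k R] [Algebra.FiniteType k R] {f : R} (hf : f ≠ 0) :
    Dense {χ : R →ₐ[k] k | χ f ≠ 0} := by
  rw [isTopologicalBasis_setOf_algHom_ne_zero.dense_iff]
  rintro _ ⟨f', rfl⟩ ⟨χ, hχ⟩
  have hf' : f' ≠ 0 := fun h0 => hχ (by rw [h0, map_zero])
  have : Nontrivial (Localization.Away (f' * f)) := by
    rw [← not_subsingleton_iff_nontrivial, IsLocalization.subsingleton_iff
      (M := Submonoid.powers (f' * f))]
    rintro ⟨n, hn⟩
    exact pow_ne_zero n (mul_ne_zero hf' hf) hn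
  have : Algebra.FiniteType k (Localization.Away (f' * f)) :=
    .trans (S := R) inferInstance
      (IsLocalization.finiteType_of_monoid_fg (Submonoid.powers (f' * f)) _)
  obtain ⟨φ⟩ := nonempty_algHom_of_finiteType k (Localization.Away (f' * f)) k
  have := ((IsLocalization.Away.algebraMap_isUnit
    (S := Localization.Away (f' * f)) (f' * f)).map φ).ne_zero
  rw [map_mul, map_mul] at this
  exact ⟨φ.comp (IsScalarTower.toAlgHom k R _), left_ne_zero_of_mul this,
    right_ne_zero_of_mul this⟩

end Spectrum

theorem IsReducedCI.isReduced {k B : Type*} [Field k] [CommRing B] [Algebra k B]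
    (hB : IsReducedCI k B) : IsReduced B := by
  obtain ⟨n, t, f, I, -, -, hI, ⟨e⟩⟩ := hB
  have : IsReduced (MvPolynomial (Fin n) k ⧸ I) := (Ideal.isRadical_iff_quotient_reduced I).1 hI
  exact isReduced_of_injective e.symm e.symm.injective

section Fibres

variable {k Λ ι : Type*} [Field k] [CommRing Λ] [Algebra k Λ] {t : ℕ} {g : Fin t → Λ}

/-- A point of `Λ` lying over `μ` belongs to the fibre of `μ`. -/
theorem mem_spZeroLocus_of_comp_algebraMap {μ : Algebra.adjoin k (Set.range g) →ₐ[k] k}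
    {χ : Λ →ₐ[k] k} (hχ : ∀ r : Algebra.adjoin k (Set.range g), χ r = μ r) :
    χ ∈ spZeroLocus k ((Ideal.span (Set.range fun i => g i - algebraMap k Λ
      (μ ⟨g i, Algebra.subset_adjoin (Set.mem_range_self i)⟩)) : Ideal Λ) : Set Λ) := by
  intro x hx
  refine (Ideal.span_le (I := RingHom.ker χ)).2 ?_ hx
  rintro _ ⟨i, rfl⟩
  rw [SetLike.mem_coe, RingHom.mem_ker, map_sub, χ.commutes, ← hχ]
  simp

theorem linearIndependent_mk_of_linearIndependent_spZeroLocus {J : Ideal Λ} [Fintype ι] {h : ι → Λ}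
    (hh : LinearIndependent k
      (fun j => (fun χ : ↥(spZeroLocus k (J : Set Λ)) => (χ : Λ →ₐ[k] k) (h j)))) :
    LinearIndependent k (fun j => Ideal.Quotient.mk J (h j)) := by
  rw [Fintype.linearIndependent_iff] at hh ⊢
  intro c hc
  refine hh c (funext fun χ => ?_)
  have hmem : ∑ j, c j • h j ∈ J := by
    rw [← Ideal.Quotient.eq_zero_iff_mem, ← hc, map_sum]
    rfl
  simpa using χ.2 _ hmem

theorem exists_ne_zero_forall_linearIndependent_spZeroLocus [IsAlgClosed k] [CharZero k]
    [IsReduced Λ] [Algebra.FiniteType k Λ] [IsDomain (Algebra.adjoin k (Set.range g))] [Fintype ι]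
    {h : ι → Λ} (hh : LinearIndependent (Algebra.adjoin k (Set.range g)) h) :
    ∃ f : Algebra.adjoin k (Set.range g), f ≠ 0 ∧
      ∀ μ : Algebra.adjoin k (Set.range g) →ₐ[k] k, μ f ≠ 0 →
        LinearIndependent k (fun j =>
          (fun χ : ↥(spZeroLocus k ((Ideal.span (Set.range fun i => g i - algebraMap k Λ
            (μ ⟨g i, Algebra.subset_adjoin (Set.mem_range_self i)⟩)) : Ideal Λ) : Set Λ)) =>
              (χ : Λ →ₐ[k] k) (h j))) := by
  have : CharZero (Algebra.adjoin k (Set.range g)) :=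
    charZero_of_injective_algebraMap (FaithfulSMul.algebraMap_injective k _)
  have : Algebra.FiniteType (Algebra.adjoin k (Set.range g)) Λ :=
    .of_restrictScalars_finiteType k _ Λ
  obtain ⟨f, hf, H⟩ := exists_ne_zero_forall_fiber_independent hh
  refine ⟨f, hf, fun μ hμ => ?_⟩
  rw [Fintype.linearIndependent_iff]
  intro c hc
  refine congrFun (H k μ.toRingHom hμ c fun χ hχ => ?_)
  let χ' : Λ →ₐ[k] k :=
    { χ with
      commutes' := fun r => (congrArg (fun φ => φ (algebraMap k _ r)) hχ).trans (μ.commutes r) }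
  have hχ' : χ' ∈ spZeroLocus k _ := mem_spZeroLocus_of_comp_algebraMap (μ := μ) (χ := χ')
    fun r => congrArg (fun φ => φ r) hχ
  have := congrFun hc ⟨χ', hχ'⟩
  simp only [Finset.sum_apply, Pi.smul_apply, smul_eq_mul, Pi.zero_apply] at this
  exact this

end Fibres

/-- Let `g = {g 1, …, g t}` be a complete intersection of homogeneous
elements for a reduced graded complete intersection affine `k`-algebra `Λ`,
`Γ = k[g 1, …, g t]`, `I = (g 1, …, g t)`, and let `h 1, …, h N ∈ Λ` be linearly
independent over `I`. For `μ ∈ Sp Γ` set `I_μ = (g 1 − g 1(μ), …, g t − g t(μ))`. Then: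
(1) there is an open dense `U₁ ⊆ Sp Γ` such that for every `μ ∈ U₁` the `h j` are linearly
independent over `I_μ`; (2) there is an open dense `U₂ ⊆ Sp Γ` such that for every
`μ ∈ U₂` the restrictions of the `h j` to `V(I_μ)` are linearly independent over `k`. -/
theorem statement14 {k : Type u} {Λ : Type v} [Field k] [IsAlgClosed k] [CharZero k]
    [CommRing Λ] [Nontrivial Λ] [Algebra k Λ] [Algebra.FiniteType k Λ]
    (𝒜 : ℕ → Submodule k Λ) [GradedAlgebra 𝒜] (h0 : 𝒜 0 = 1)
    (hredCI : IsReducedCI k Λ)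
    {t : ℕ} (g : Fin t → Λ) (d : Fin t → ℕ) (hhom : ∀ i, g i ∈ 𝒜 (d i))
    (hCI : IsCompleteIntersection k g)
    {N : ℕ} (h : Fin N → Λ)
    (hindep : LinearIndependent k
      (fun j => Ideal.Quotient.mk (Ideal.span (Set.range g)) (h j))) :
    (∃ U₁ : Set (↥(Algebra.adjoin k (Set.range g)) →ₐ[k] k),
        IsOpen U₁ ∧ Dense U₁ ∧
          ∀ μ ∈ U₁,
            LinearIndependent k (fun j =>
              Ideal.Quotient.mk
                (Ideal.span (Set.range fun i =>
                  g i - algebraMap k Λ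
                    (μ ⟨g i, Algebra.subset_adjoin (Set.mem_range_self i)⟩)))
                (h j))) ∧
      (∃ U₂ : Set (↥(Algebra.adjoin k (Set.range g)) →ₐ[k] k),
        IsOpen U₂ ∧ Dense U₂ ∧
          ∀ μ ∈ U₂,
            LinearIndependent k (fun j =>
              (fun χ : ↥(spZeroLocus k
                  ((Ideal.span (Set.range fun i =>
                    g i - algebraMap k Λ
                      (μ ⟨g i, Algebra.subset_adjoin (Set.mem_range_self i)⟩)) :
                    Ideal Λ) : Set Λ)) =>
                (χ : Λ →ₐ[k] k) (h j)))) := by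
  have := hredCI.isReduced
  have hg := hCI.onlyTrivialRelations
  have := (hg.algebraicIndependent (k := k) hCI.2).aevalEquiv.symm.toMulEquiv.isDomain
  have : Algebra.FiniteType k (Algebra.adjoin k (Set.range g)) :=
    .equiv inferInstance (hg.algebraicIndependent (k := k) hCI.2).aevalEquiv
  obtain ⟨f, hf, H⟩ :=
    exists_ne_zero_forall_linearIndependent_spZeroLocus (hg.linearIndependent_adjoin hindep)
  have hopen := isOpen_setOf_algHom_ne_zero (k := k) f
  have hdense := dense_setOf_algHom_ne_zero (k := k) hf
  exact ⟨⟨_, hopen, hdense, fun μ hμ =>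
    linearIndependent_mk_of_linearIndependent_spZeroLocus (H μ hμ)⟩, _, hopen, hdense, H⟩

end
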